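/- For n = 4t+1 with t ≥ 4, the set {u_0, v_{2t−5}, v_{2t−4}} is an edge metric generator of GP(n,2), hence β_E(GP(4t+1,2)) = 3. -/

import Mathlib

open SimpleGraph

/-- Distance from a vertex to an edge: `d(w,e) = min over endpoints`. -/
noncomputable def edgeDist {V : Type*} (G : SimpleGraph V) (w : V) (e : Sym2 V) : ℕ :=
  Sym2.lift ⟨fun x y => min (G.dist w x) (G.dist w y), fun x y => min_comm _ _⟩ e

/-- `S` is an edge metric generator: distinct edges get distinct distance vectors. -/
def IsEdgeGenerator {V : Type*} (G : SimpleGraph V) (S : Set V) : Prop :=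
  ∀ e₁ ∈ G.edgeSet, ∀ e₂ ∈ G.edgeSet,
    (∀ w ∈ S, edgeDist G w e₁ = edgeDist G w e₂) → e₁ = e₂

/-- The edge metric dimension: minimum cardinality of an edge metric generator. -/
noncomputable def edgeMetricDim {V : Type*} (G : SimpleGraph V) : ℕ :=
  sInf {n | ∃ S : Set V, S.Finite ∧ S.ncard = n ∧ IsEdgeGenerator G S}

/-- `S` resolves all pairs of vertices. -/
def IsResolving {V : Type*} (G : SimpleGraph V) (S : Set V) : Prop :=
  ∀ x y : V, (∀ w ∈ S, G.dist w x = G.dist w y) → x = y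

/-- The metric dimension. -/
noncomputable def metricDim {V : Type*} (G : SimpleGraph V) : ℕ :=
  sInf {n | ∃ S : Set V, S.Finite ∧ S.ncard = n ∧ IsResolving G S}

/-- The generalized Petersen graph `GP n k`: outer vertices `Sum.inl i` (the `uᵢ`),
inner vertices `Sum.inr i` (the `vᵢ`). -/
def GP (n k : ℕ) : SimpleGraph (Fin n ⊕ Fin n) :=
  SimpleGraph.fromRel (fun a b =>
    match a, b with
    | Sum.inl i, Sum.inl j => (j : ℕ) = ((i : ℕ) + 1) % n
    | Sum.inl i, Sum.inr j => i = j
    | Sum.inr i, Sum.inr j => (j : ℕ) = ((i : ℕ) + k) % n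
    | _, _ => False)

lemma gp_adj_uu {t : ℕ} (ht : 4 ≤ t) (i j : Fin (4*t+1)) :
    (GP (4*t+1) 2).Adj (Sum.inl i) (Sum.inl j) ↔
      ((j:ℕ) = i + 1 ∨ (i:ℕ) = j + 1 ∨ ((i:ℕ) = 4*t ∧ (j:ℕ) = 0) ∨ ((j:ℕ) = 4*t ∧ (i:ℕ) = 0)) := by
  have hi := i.2
  have hj := j.2
  have e1 : ((i:ℕ)+1) % (4*t+1) = if (i:ℕ) = 4*t then 0 else (i:ℕ)+1 := by
    split_ifs with h
    · rw [h]; exact Nat.mod_self _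
    · exact Nat.mod_eq_of_lt (by omega)
  have e2 : ((j:ℕ)+1) % (4*t+1) = if (j:ℕ) = 4*t then 0 else (j:ℕ)+1 := by
    split_ifs with h
    · rw [h]; exact Nat.mod_self _
    · exact Nat.mod_eq_of_lt (by omega)
  simp only [GP, SimpleGraph.fromRel_adj, e1, e2, ne_eq, Sum.inl.injEq, Fin.ext_iff]
  split_ifs <;> omega

lemma gp_adj_vv {t : ℕ} (ht : 4 ≤ t) (i j : Fin (4*t+1)) :
    (GP (4*t+1) 2).Adj (Sum.inr i) (Sum.inr j) ↔
      ((j:ℕ) = i + 2 ∨ (i:ℕ) = j + 2 ∨ ((i:ℕ) + 2 = j + (4*t+1)) ∨ ((j:ℕ) + 2 = i + (4*t+1))) := by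
  have hi := i.2
  have hj := j.2
  have e : ∀ k : ℕ, k < 4*t+1 → (k+2) % (4*t+1) = if k + 2 < 4*t+1 then k+2 else k+2-(4*t+1) := by
    intro k hk
    split_ifs with h
    · exact Nat.mod_eq_of_lt h
    · rw [Nat.mod_eq_sub_mod (by omega)]; exact Nat.mod_eq_of_lt (by omega)
  simp only [GP, SimpleGraph.fromRel_adj, e _ hi, e _ hj, ne_eq, Sum.inr.injEq, Fin.ext_iff]
  split_ifs <;> omega

lemma uu' {t : ℕ} (ht : 4 ≤ t) (i j : ℕ) (hi : i < 4*t+1) (hj : j < 4*t+1)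
    (h : j = i + 1 ∨ i = j + 1 ∨ (i = 4*t ∧ j = 0) ∨ (j = 4*t ∧ i = 0)) :
    (GP (4*t+1) 2).Adj (Sum.inl ⟨i, hi⟩) (Sum.inl ⟨j, hj⟩) := (gp_adj_uu ht _ _).2 h

lemma vv' {t : ℕ} (ht : 4 ≤ t) (i j : ℕ) (hi : i < 4*t+1) (hj : j < 4*t+1)
    (h : j = i + 2 ∨ i = j + 2 ∨ (i + 2 = j + (4*t+1)) ∨ (j + 2 = i + (4*t+1))) :
    (GP (4*t+1) 2).Adj (Sum.inr ⟨i, hi⟩) (Sum.inr ⟨j, hj⟩) := (gp_adj_vv ht _ _).2 h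

lemma gp_adj_uv {n : ℕ} (i j : Fin n) :
    (GP n 2).Adj (Sum.inl i) (Sum.inr j) ↔ i = j := by
  simp [GP, SimpleGraph.fromRel_adj]

lemma gp_adj_vu {n : ℕ} (i j : Fin n) :
    (GP n 2).Adj (Sum.inr i) (Sum.inl j) ↔ i = j := by
  rw [SimpleGraph.adj_comm, gp_adj_uv, eq_comm]

lemma dist_eq_of_potential {V : Type*} (G : SimpleGraph V) (w : V) (f : V → ℕ)
    (h0 : f w = 0) (hw : ∀ x, f x = 0 → x = w)
    (h1 : ∀ x y, G.Adj x y → f y ≤ f x + 1)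
    (h2 : ∀ x, f x ≠ 0 → ∃ y, G.Adj y x ∧ f y < f x) (x : V) : G.dist w x = f x := by
  have ub : ∀ k x, f x ≤ k → ∃ p : G.Walk w x, p.length ≤ f x := by
    intro k
    induction k with
    | zero =>
      intro x hx
      obtain rfl := hw x (by omega)
      exact ⟨SimpleGraph.Walk.nil, by simp⟩
    | succ k ih =>
      intro x hx
      by_cases hz : f x = 0
      · obtain rfl := hw x hz
        exact ⟨SimpleGraph.Walk.nil, by simp⟩
      · obtain ⟨y, hy, hlt⟩ := h2 x hz
        obtain ⟨p, hp⟩ := ih y (by omega)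
        exact ⟨p.concat hy, by rw [SimpleGraph.Walk.length_concat]; omega⟩
  have lb : ∀ {a b : V} (p : G.Walk a b), f b ≤ f a + p.length := by
    intro a b p
    induction p with
    | nil => simp
    | cons h p ih =>
      have := h1 _ _ h
      rw [SimpleGraph.Walk.length_cons]
      omega
  obtain ⟨p, hp⟩ := ub _ x le_rfl
  apply le_antisymm ((SimpleGraph.dist_le p).trans hp)
  obtain ⟨q, hq⟩ := SimpleGraph.Reachable.exists_walk_length_eq_dist ⟨p⟩
  have := lb q
  omega

/-- `dist(u_0,u_d)` -/
def aU (t d : ℕ) : ℕ := min (min d (4*t+1-d)) ((min d (4*t+1-d) + 1)/2 + 2)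
/-- `dist(u_0,v_d) = dist(v_0,u_d)` -/
def bU (t d : ℕ) : ℕ := (min d (4*t+1-d) + 1)/2 + 1
/-- `dist(v_0,v_d)` -/
def bV (t d : ℕ) : ℕ := min (d/2 + 3*(d%2)) ((4*t+1-d)/2 + 3*((4*t+1-d)%2))

lemma dist_u0 {t : ℕ} (ht : 4 ≤ t) (h : 0 < 4*t+1) (x) :
    (GP (4*t+1) 2).dist (Sum.inl ⟨0, h⟩) x =
      Sum.elim (fun i : Fin _ => aU t i) (fun i : Fin _ => bU t i) x := by
  apply dist_eq_of_potential
  · simp [aU]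
  · rintro (⟨i, hi⟩ | ⟨i, hi⟩) hx
    · simp only [Sum.elim_inl, aU] at hx
      simp only [Sum.inl.injEq, Fin.mk.injEq]
      omega
    · simp [bU] at hx
  · rintro (⟨i, hi⟩ | ⟨i, hi⟩) (⟨j, hj⟩ | ⟨j, hj⟩) hx
    · rw [gp_adj_uu ht] at hx
      simp only [Sum.elim_inl, aU] at hx ⊢
      omega
    · rw [gp_adj_uv] at hx
      simp only [Fin.mk.injEq] at hx
      subst hx
      simp only [Sum.elim_inl, Sum.elim_inr, aU, bU]
      omega
    · rw [gp_adj_vu] at hx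
      simp only [Fin.mk.injEq] at hx
      subst hx
      simp only [Sum.elim_inl, Sum.elim_inr, aU, bU]
      omega
    · rw [gp_adj_vv ht] at hx
      simp only [Sum.elim_inr, bU] at hx ⊢
      omega
  · rintro (⟨i, hi⟩ | ⟨i, hi⟩) hx
    · simp only [Sum.elim_inl, aU] at hx
      by_cases h1 : i ≤ 4
      · refine ⟨Sum.inl ⟨i-1, by omega⟩, uu' ht _ _ _ _ (by omega), ?_⟩
        change aU t (i-1) < aU t i
        simp only [aU]; omega
      by_cases h2 : i + 1 ≤ 4*t - 3
      · refine ⟨Sum.inr ⟨i, hi⟩, (gp_adj_vu _ _).2 rfl, ?_⟩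
        simp only [Sum.elim_inl, Sum.elim_inr, aU, bU]; omega
      by_cases h3 : i = 4 * t
      · refine ⟨Sum.inl ⟨0, by omega⟩, uu' ht _ _ _ _ (by omega), ?_⟩
        change aU t (0) < aU t i
        simp only [aU]; omega
      · refine ⟨Sum.inl ⟨i+1, by omega⟩, uu' ht _ _ _ _ (by omega), ?_⟩
        change aU t (i+1) < aU t i
        simp only [aU]; omega
    · clear hx
      by_cases h1 : i ≤ 1 ∨ i = 4*t
      · refine ⟨Sum.inl ⟨i, hi⟩, (gp_adj_uv _ _).2 rfl, ?_⟩
        simp only [Sum.elim_inl, Sum.elim_inr, aU, bU]; omega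
      by_cases h2 : i ≤ 2*t
      · refine ⟨Sum.inr ⟨i-2, by omega⟩, vv' ht _ _ _ _ (by omega), ?_⟩
        change bU t (i-2) < bU t i
        simp only [bU]; omega
      by_cases h3 : i = 4*t-1
      · refine ⟨Sum.inr ⟨0, by omega⟩, vv' ht _ _ _ _ (by omega), ?_⟩
        change bU t (0) < bU t i
        simp only [bU]; omega
      · refine ⟨Sum.inr ⟨i+2, by omega⟩, vv' ht _ _ _ _ (by omega), ?_⟩
        change bU t (i+2) < bU t i
        simp only [bU]; omega

/-- absolute difference -/
def dd (i s : ℕ) : ℕ := (i - s) + (s - i)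

lemma next_exists {n : ℕ} (i r : ℕ) (hr : r < n) (hi : i < n) : ∃ j, j < n ∧ (j = i + r ∨ j + n = i + r) := by
  by_cases h : i + r < n
  · exact ⟨i + r, h, Or.inl rfl⟩
  · exact ⟨i + r - n, by omega, by omega⟩

lemma prev_exists {n : ℕ} (i r : ℕ) (hr : r < n) (hi : i < n) : ∃ j, j < n ∧ (j + r = i ∨ j + r = i + n) := by
  by_cases h : r ≤ i
  · exact ⟨i - r, by omega, by omega⟩
  · exact ⟨i + n - r, by omega, by omega⟩

lemma bV_lip1 {t d e : ℕ} (hd : d < 4*t+1) (he : e < 4*t+1)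
    (h : e = d + 2 ∨ d = e + 2 ∨ d = e ∨ d + e + 2 = 4*t+1 ∨ d + e = 4*t+1) :
    bV t e ≤ bV t d + 1 := by
  simp only [bV]
  rcases Nat.mod_two_eq_zero_or_one d with h3 | h3 <;>
  rcases h with h | h | h | h | h <;> omega

lemma bV_lip {t i j s : ℕ} (hi : i < 4*t+1) (hj : j < 4*t+1) (hs : s < 4*t+1)
    (hx : j = i + 2 ∨ i = j + 2 ∨ (i + 2 = j + (4*t+1)) ∨ (j + 2 = i + (4*t+1))) :
    bV t (dd j s) ≤ bV t (dd i s) + 1 := by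
  have h1 : dd j s + s = j ∨ dd j s + j = s := by unfold dd; omega
  have h2 : dd i s + s = i ∨ dd i s + i = s := by unfold dd; omega
  by_cases h3 : dd i s + dd j s = 2
  · have : dd i s = 0 ∨ dd i s = 1 ∨ dd i s = 2 := by omega
    rcases this with h | h | h
    · exact bV_lip1 (by omega) (by omega) (by omega)
    · exact bV_lip1 (by omega) (by omega) (by omega)
    · exact bV_lip1 (by omega) (by omega) (by omega)
  · apply bV_lip1 <;> omega

lemma bV_desc {t i p q s : ℕ} (ht : 4 ≤ t) (hi : i < 4*t+1) (hp : p < 4*t+1) (hq : q < 4*t+1)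
    (hs : s < 4*t+1) (hd : dd i s ≠ 0) (hp' : p + 2 = i ∨ p + 2 = i + (4*t+1))
    (hq' : q = i + 2 ∨ q + (4*t+1) = i + 2) :
    bU t (dd i s) < bV t (dd i s) ∨ bV t (dd p s) < bV t (dd i s) ∨
          bV t (dd q s) < bV t (dd i s) := by
  have h1 : dd p s + s = p ∧ s ≤ p ∨ dd p s + p = s ∧ p < s := by unfold dd; omega
  have h2 : dd i s + s = i ∧ s ≤ i ∨ dd i s + i = s ∧ i < s := by unfold dd; omega
  have h3 : dd q s + s = q ∧ s ≤ q ∨ dd q s + q = s ∧ q < s := by unfold dd; omega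
  generalize dd p s = x at *
  generalize dd i s = d at *
  generalize dd q s = y at *
  have hdn : d ≤ 4*t := by omega
  rcases Nat.mod_two_eq_zero_or_one d with h4 | h4
  · by_cases h5 : d ≤ 2*t+2
    · right
      have : x + 2 = d ∨ y + 2 = d := by omega
      rcases this with h | h
      · left; clear h1 h2 h3 hp' hq'; simp only [bV]; omega
      · right; clear h1 h2 h3 hp' hq'; simp only [bV]; omega
    · left; clear h1 h2 h3 hp' hq'; simp only [bV, bU]; omega
  · by_cases h5 : 4*t+1-d ≤ 2*t+2
    · right
      have : (x = d + 2 ∨ x + d + 2 = 4*t+1) ∨ (y = d+2 ∨ y + d + 2 = 4*t+1) := by omega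
      rcases this with h | h
      · left; clear h1 h2 h3 hp' hq'; simp only [bV]; omega
      · right; clear h1 h2 h3 hp' hq'; simp only [bV]; omega
    · left; clear h1 h2 h3 hp' hq'; simp only [bV, bU]; omega

lemma dist_v {t : ℕ} (ht : 4 ≤ t) (s : ℕ) (h : s < 4*t+1) (x) :
    (GP (4*t+1) 2).dist (Sum.inr ⟨s, h⟩) x =
      Sum.elim (fun i : Fin _ => bU t (dd i s)) (fun i : Fin _ => bV t (dd i s)) x := by
  apply dist_eq_of_potential
  · simp [bV, dd]
  · rintro (⟨i, hi⟩ | ⟨i, hi⟩) hx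
    · simp [bU] at hx
    · simp only [Sum.elim_inr, bV, dd] at hx
      simp only [Sum.inr.injEq, Fin.mk.injEq]
      omega
  · rintro (⟨i, hi⟩ | ⟨i, hi⟩) (⟨j, hj⟩ | ⟨j, hj⟩) hx
    · rw [gp_adj_uu ht] at hx
      simp only [Sum.elim_inl, bU, dd] at hx ⊢
      omega
    · rw [gp_adj_uv] at hx
      simp only [Fin.mk.injEq] at hx
      subst hx
      simp only [Sum.elim_inl, Sum.elim_inr, bV, bU, dd]
      omega
    · rw [gp_adj_vu] at hx
      simp only [Fin.mk.injEq] at hx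
      subst hx
      simp only [Sum.elim_inl, Sum.elim_inr, bV, bU, dd]
      omega
    · rw [gp_adj_vv ht] at hx
      change bV t (dd j s) ≤ bV t (dd i s) + 1
      exact bV_lip hi hj h hx
  · rintro (⟨i, hi⟩ | ⟨i, hi⟩) hx
    · obtain ⟨p, hp, hp'⟩ := prev_exists i 1 (by omega) hi
      obtain ⟨q, hq, hq'⟩ := next_exists i 1 (by omega) hi
      have : bV t (dd i s) < bU t (dd i s) ∨ bU t (dd p s) < bU t (dd i s) ∨
          bU t (dd q s) < bU t (dd i s) := by
        clear hx
        simp only [bV, bU, dd]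
        rcases Nat.le_total s i with h1 | h1 <;>
        rcases Nat.mod_two_eq_zero_or_one (i + s) with h3 | h3 <;>
        rcases Nat.le_total (2 * ((i-s)+(s-i))) (4*t+1) with h2 | h2
        · left; omega
        · right; right; omega
        · right; left; omega
        · left; omega
        · left; omega
        · right; left; omega
        · right; right; omega
        · left; omega
      rcases this with h1 | h1 | h1
      · exact ⟨Sum.inr ⟨i, hi⟩, (gp_adj_vu _ _).2 rfl, h1⟩
      · exact ⟨Sum.inl ⟨p, hp⟩, uu' ht _ _ _ _ (by omega), h1⟩
      · exact ⟨Sum.inl ⟨q, hq⟩, uu' ht _ _ _ _ (by omega), h1⟩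
    · obtain ⟨p, hp, hp'⟩ := prev_exists i 2 (by omega) hi
      obtain ⟨q, hq, hq'⟩ := next_exists i 2 (by omega) hi
      have : bU t (dd i s) < bV t (dd i s) ∨ bV t (dd p s) < bV t (dd i s) ∨
          bV t (dd q s) < bV t (dd i s) := by
        have hd : dd i s ≠ 0 := by
          intro h0
          apply hx
          simp only [Sum.elim_inr, h0]
          simp [bV]
        exact bV_desc ht hi hp hq h hd hp' hq'
      rcases this with h1 | h1 | h1
      · exact ⟨Sum.inl ⟨i, hi⟩, (gp_adj_uv _ _).2 rfl, h1⟩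
      · exact ⟨Sum.inr ⟨p, hp⟩, vv' ht _ _ _ _ (by omega), h1⟩
      · exact ⟨Sum.inr ⟨q, hq⟩, vv' ht _ _ _ _ (by omega), h1⟩

lemma subset_pair {V : Type*} [Nonempty V] (S : Set V) (hf : S.Finite) (hS : S.ncard ≤ 2) :
    ∃ w s, S ⊆ {w, s} := by
  obtain ⟨v⟩ := ‹Nonempty V›
  interval_cases h : S.ncard
  · rw [Set.ncard_eq_zero hf] at h
    exact ⟨v, v, by simp [h]⟩
  · obtain ⟨a, rfl⟩ := Set.ncard_eq_one.1 h
    exact ⟨a, a, by simp⟩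
  · obtain ⟨a, b, -, rfl⟩ := Set.ncard_eq_two.1 h
    exact ⟨a, b, subset_rfl⟩

lemma lower {V : Type*} [Nonempty V] (G : SimpleGraph V)
    (hG : ∀ w, ∃ x y z, G.Adj w x ∧ G.Adj w y ∧ G.Adj w z ∧ x ≠ y ∧ x ≠ z ∧ y ≠ z)
    (S : Set V) (hf : S.Finite) (hS : IsEdgeGenerator G S) : 3 ≤ S.ncard := by
  by_contra hlt
  obtain ⟨w, s, hws⟩ := subset_pair S hf (by omega)
  obtain ⟨x, y, z, hx, hy, hz, hxy, hxz, hyz⟩ := hG w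
  have key : ∀ a b, G.Adj w a → G.Adj w b → a ≠ b →
      edgeDist G s s(w, a) ≠ edgeDist G s s(w, b) := by
    intro a b ha hb hab he
    have := hS s(w, a) ha s(w, b) hb (by
      intro r hr
      rcases hws hr with rfl | rfl
      · simp [edgeDist]
      · exact he)
    rw [Sym2.congr_right] at this
    exact hab this
  have k1 := key x y hx hy hxy
  have k2 := key x z hx hz hxz
  have k3 := key y z hy hz hyz
  have d1 := hx.diff_dist_adj (u := s)
  have d2 := hy.diff_dist_adj (u := s)
  have d3 := hz.diff_dist_adj (u := s)
  simp only [edgeDist, Sym2.lift_mk] at k1 k2 k3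
  omega

lemma gp_three {t : ℕ} (ht : 4 ≤ t) (w) : ∃ x y z, (GP (4*t+1) 2).Adj w x ∧ (GP (4*t+1) 2).Adj w y ∧
    (GP (4*t+1) 2).Adj w z ∧ x ≠ y ∧ x ≠ z ∧ y ≠ z := by
  rcases w with ⟨i, hi⟩ | ⟨i, hi⟩
  · obtain ⟨p, hp, hp'⟩ := prev_exists i 1 (by omega) hi
    obtain ⟨q, hq, hq'⟩ := next_exists i 1 (by omega) hi
    refine ⟨Sum.inl ⟨p, hp⟩, Sum.inl ⟨q, hq⟩, Sum.inr ⟨i, hi⟩, uu' ht _ _ _ _ (by omega),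
      uu' ht _ _ _ _ (by omega), (gp_adj_uv _ _).2 rfl, ?_, by simp, by simp⟩
    simp only [ne_eq, Sum.inl.injEq, Fin.mk.injEq]; omega
  · obtain ⟨p, hp, hp'⟩ := prev_exists i 2 (by omega) hi
    obtain ⟨q, hq, hq'⟩ := next_exists i 2 (by omega) hi
    refine ⟨Sum.inr ⟨p, hp⟩, Sum.inr ⟨q, hq⟩, Sum.inl ⟨i, hi⟩, vv' ht _ _ _ _ (by omega),
      vv' ht _ _ _ _ (by omega), (gp_adj_vu _ _).2 rfl, ?_, by simp, by simp⟩
    simp only [ne_eq, Sum.inr.injEq, Fin.mk.injEq]; omega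
/-- data of a family of edges whose index is at most `2t-1` -/
def QA (t i a b c : ℕ) (lo hi k p q : ℤ) : Prop :=
  lo ≤ i ∧ (i:ℤ) ≤ hi ∧ (i:ℤ) = 2*a+k ∧ (a:ℤ)+b = t+p ∧ (b:ℤ) = c+q

/-- data of a family of edges whose index is at least `2t` -/
def QB (t i a b c : ℕ) (lo hi k p q : ℤ) : Prop :=
  lo ≤ i ∧ (i:ℤ) ≤ hi ∧ (i:ℤ) = 4*t+k-2*a ∧ (a:ℤ)+b = t+p ∧ (b:ℤ) = c+q

lemma QA.mk {t i a b c : ℕ} {lo hi k p q : ℤ} (h1 : lo ≤ i) (h2 : (i:ℤ) ≤ hi) (h3 : (i:ℤ) = 2*a+k)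
    (h4 : (i:ℤ) = 2*a+k → (a:ℤ)+b = t+p)
    (h5 : (i:ℤ) = 2*a+k → (a:ℤ)+b = t+p → (b:ℤ) = c+q) : QA t i a b c lo hi k p q :=
  ⟨h1, h2, h3, h4 h3, h5 h3 (h4 h3)⟩

lemma QB.mk {t i a b c : ℕ} {lo hi k p q : ℤ} (h1 : lo ≤ i) (h2 : (i:ℤ) ≤ hi)
    (h3 : (i:ℤ) = 4*t+k-2*a)
    (h4 : (i:ℤ) = 4*t+k-2*a → (a:ℤ)+b = t+p)
    (h5 : (i:ℤ) = 4*t+k-2*a → (a:ℤ)+b = t+p → (b:ℤ) = c+q) : QB t i a b c lo hi k p q :=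
  ⟨h1, h2, h3, h4 h3, h5 h3 (h4 h3)⟩

/-- codes of the edges of type 0 -/
def Code0 (t i a b c : ℕ) : Prop :=
  QA t i a b c 0 0 0 (-2) (-1) ∨
  QA t i a b c 2 2 (-2) (-1) (-1) ∨
  QA t i a b c 4 (2*t-6) (-4) 0 (-1) ∨
  QA t i a b c (2*t-4) (2*t-4) (-4) 2 1 ∨
  QA t i a b c (2*t-2) (2*t-2) (-4) 4 1 ∨
  QB t i a b c (2*t) (4*t-6) 4 6 1 ∨
  QB t i a b c (4*t-4) (4*t-4) 4 5 0 ∨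
  QB t i a b c (4*t-2) (4*t-2) 2 2 0 ∨
  QB t i a b c (4*t) (4*t) 0 (-1) 0 ∨
  QA t i a b c 1 1 (-1) (-1) 0 ∨
  QA t i a b c 3 3 (-3) 0 0 ∨
  QA t i a b c 5 (2*t-5) (-5) 1 0 ∨
  QA t i a b c (2*t-3) (2*t-3) (-5) 3 0 ∨
  QA t i a b c (2*t-1) (2*t-1) (-5) 5 0 ∨
  QB t i a b c (2*t+1) (4*t-5) 5 6 0 ∨
  QB t i a b c (4*t-3) (4*t-3) 3 3 (-1) ∨
  QB t i a b c (4*t-1) (4*t-1) 1 0 (-1)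

/-- codes of the edges of type 1 -/
def Code1 (t i a b c : ℕ) : Prop :=
  QA t i a b c 0 0 0 (-1) 1 ∨
  QA t i a b c 2 (2*t-6) (-2) 0 1 ∨
  QA t i a b c (2*t-4) (2*t-4) (-2) 1 2 ∨
  QA t i a b c (2*t-2) (2*t-2) (-2) 3 2 ∨
  QB t i a b c (2*t) (2*t) 2 5 2 ∨
  QB t i a b c (2*t+2) (4*t-6) 4 6 2 ∨
  QB t i a b c (4*t-4) (4*t-4) 4 4 0 ∨
  QB t i a b c (4*t-2) (4*t-2) 4 2 (-2) ∨
  QB t i a b c (4*t) (4*t) 2 (-1) (-2) ∨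
  QA t i a b c 1 1 (-1) (-2) (-2) ∨
  QA t i a b c 3 (2*t-5) (-3) (-1) (-2) ∨
  QA t i a b c (2*t-3) (2*t-3) (-3) 1 (-1) ∨
  QA t i a b c (2*t-1) (2*t-1) (-3) 3 (-1) ∨
  QB t i a b c (2*t+1) (4*t-5) 3 4 (-1) ∨
  QB t i a b c (4*t-3) (4*t-3) 3 4 1 ∨
  QB t i a b c (4*t-1) (4*t-1) 3 2 1

/-- codes of the edges of type 2 -/
def Code2 (t i a b c : ℕ) : Prop :=
  QA t i a b c 0 (2*t-8) (-2) 0 2 ∨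
  QA t i a b c (2*t-6) (2*t-6) (-2) 1 3 ∨
  QA t i a b c (2*t-4) (2*t-4) (-2) 2 3 ∨
  QA t i a b c (2*t-2) (2*t-2) (-2) 4 3 ∨
  QB t i a b c (2*t) (4*t-8) 2 6 3 ∨
  QB t i a b c (4*t-6) (4*t-6) 2 4 1 ∨
  QB t i a b c (4*t-4) (4*t-4) 2 2 (-1) ∨
  QB t i a b c (4*t-2) (4*t-2) 2 0 (-3) ∨
  QB t i a b c (4*t) (4*t) 4 (-1) (-3) ∨
  QA t i a b c 1 (2*t-7) (-3) (-2) (-3) ∨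
  QA t i a b c (2*t-5) (2*t-5) (-3) (-1) (-3) ∨
  QA t i a b c (2*t-3) (2*t-3) (-3) 1 (-2) ∨
  QA t i a b c (2*t-1) (2*t-1) (-3) 3 (-2) ∨
  QB t i a b c (2*t+1) (4*t-7) 1 3 (-2) ∨
  QB t i a b c (4*t-5) (4*t-5) 1 3 0 ∨
  QB t i a b c (4*t-3) (4*t-3) 1 3 2 ∨
  QB t i a b c (4*t-1) (4*t-1) 1 1 2

lemma chain {x : ℤ} {p q : Prop} (y : ℤ) (h1 : x ≤ y → p) (h2 : y < x → q) : p ∨ q :=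
  (le_or_gt x y).imp h1 h2

lemma aU_lo {t d : ℕ} (h : d ≤ 2*t) : aU t d = min d ((d+1)/2+2) := by
  simp only [aU, Nat.min_eq_left (show d ≤ 4*t+1-d by omega)]

lemma aU_hi {t d : ℕ} (h : 2*t < d) : aU t d = min (4*t+1-d) ((4*t+1-d+1)/2+2) := by
  simp only [aU, Nat.min_eq_right (show 4*t+1-d ≤ d by omega)]

lemma bU_lo {t d : ℕ} (h : d ≤ 2*t) : bU t d = (d+1)/2+1 := by
  simp only [bU, Nat.min_eq_left (show d ≤ 4*t+1-d by omega)]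

lemma bU_hi {t d : ℕ} (h : 2*t < d) : bU t d = (4*t+1-d+1)/2+1 := by
  simp only [bU, Nat.min_eq_right (show 4*t+1-d ≤ d by omega)]

lemma bV1 {t d : ℕ} (h : d % 2 = 0 ∧ d ≤ 2*t+2 ∧ 1 ≤ t) : bV t d = d/2 := by
  have : (4*t+1-d) % 2 = 1 ∨ 4*t+1 ≤ d := by omega
  simp only [bV]; omega

lemma bV2 {t d : ℕ} (h : d % 2 = 1 ∧ d + 2 ≤ 2*t) : bV t d = (d+5)/2 := by
  have : (4*t+1-d) % 2 = 0 := by omega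
  simp only [bV]; omega

lemma bV3 {t d : ℕ} (h : d % 2 = 1 ∧ 2*t ≤ d + 2 ∧ d ≤ 4*t) : bV t d = (4*t+1-d)/2 := by
  have : (4*t+1-d) % 2 = 0 := by omega
  simp only [bV]; omega

lemma bV4 {t d : ℕ} (h : d % 2 = 0 ∧ 2*t+4 ≤ d ∧ d ≤ 4*t) : bV t d = (4*t+6-d)/2 := by
  have : (4*t+1-d) % 2 = 1 := by omega
  simp only [bV]; omega

lemma dd_le {i s : ℕ} (h : i ≤ s) : dd i s = s - i := by
  simp only [dd]; omega

lemma dd_ge {i s : ℕ} (h : s ≤ i) : dd i s = i - s := by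
  simp only [dd]; omega

set_option maxHeartbeats 4000000 in
lemma code0 {t i j a b c : ℕ} (ht : 4 ≤ t) (hi : i < 4*t+1) (hj2 : j < 4*t+1) (hj : j = i + 1 ∨ i = 4*t ∧ j = 0)
    (ha : a = min (aU t i) (aU t j))
    (hb : b = min (bU t (dd i (2*t-5))) (bU t (dd j (2*t-5))))
    (hc : c = min (bU t (dd i (2*t-4))) (bU t (dd j (2*t-4)))) : Code0 t i a b c := by
  rcases Nat.mod_two_eq_zero_or_one i with hm | hm
  on_goal 1 =>
    refine
      chain (x := i) 0 (fun h => ?_) fun h =>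
      chain (x := i) 2 (fun h => ?_) fun h =>
      chain (x := i) (2*t-6) (fun h => ?_) fun h =>
      chain (x := i) (2*t-4) (fun h => ?_) fun h =>
      chain (x := i) (2*t-2) (fun h => ?_) fun h =>
      chain (x := i) (4*t-6) (fun h => ?_) fun h =>
      chain (x := i) (4*t-4) (fun h => ?_) fun h =>
      chain (x := i) (4*t-2) (fun h => ?_) fun h =>
      .inl ?_
  on_goal 10 =>
    refine .inr <| .inr <| .inr <| .inr <| .inr <| .inr <| .inr <| .inr <| .inr <|
      chain (x := i) 1 (fun h => ?_) fun h =>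
      chain (x := i) 3 (fun h => ?_) fun h =>
      chain (x := i) (2*t-5) (fun h => ?_) fun h =>
      chain (x := i) (2*t-3) (fun h => ?_) fun h =>
      chain (x := i) (2*t-1) (fun h => ?_) fun h =>
      chain (x := i) (4*t-5) (fun h => ?_) fun h =>
      chain (x := i) (4*t-3) (fun h => ?_) fun h =>
      ?_
  all_goals
    first | replace hj : j = i + 1 := by clear ha hb hc; omega | replace hj : j + (4*t+1) = i + 1 := by clear ha hb hc; omega
    first | rw [dd_le (i := i) (by clear ha hb hc; omega)] at hb | rw [dd_ge (i := i) (by clear ha hb hc; omega)] at hb | rw [dd] at hb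
    first | rw [dd_le (i := j) (by clear ha hb hc; omega)] at hb | rw [dd_ge (i := j) (by clear ha hb hc; omega)] at hb | rw [dd] at hb
    first | rw [dd_le (i := i) (by clear ha hb hc; omega)] at hc | rw [dd_ge (i := i) (by clear ha hb hc; omega)] at hc | rw [dd] at hc
    first | rw [dd_le (i := j) (by clear ha hb hc; omega)] at hc | rw [dd_ge (i := j) (by clear ha hb hc; omega)] at hc | rw [dd] at hc
    first | rw [aU_lo (by clear ha hb hc; omega)] at ha | rw [aU_hi (by clear ha hb hc; omega)] at ha | rw [aU] at ha
    first | rw [aU_lo (by clear ha hb hc; omega)] at ha | rw [aU_hi (by clear ha hb hc; omega)] at ha | rw [aU] at ha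
    first | rw [bU_lo (by clear ha hb hc; omega)] at hb | rw [bU_hi (by clear ha hb hc; omega)] at hb | rw [bU] at hb
    first | rw [bU_lo (by clear ha hb hc; omega)] at hb | rw [bU_hi (by clear ha hb hc; omega)] at hb | rw [bU] at hb
    first | rw [bU_lo (by clear ha hb hc; omega)] at hc | rw [bU_hi (by clear ha hb hc; omega)] at hc | rw [bU] at hc
    first | rw [bU_lo (by clear ha hb hc; omega)] at hc | rw [bU_hi (by clear ha hb hc; omega)] at hc | rw [bU] at hc
    first
    | exact QA.mk (by clear ha hb hc; omega) (by clear ha hb hc; omega)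
        (by clear hb hc; omega) (fun e1 => by clear ha hc; omega)
        (fun e1 e2 => by clear ha hb; omega)
    | exact QB.mk (by clear ha hb hc; omega) (by clear ha hb hc; omega)
        (by clear hb hc; omega) (fun e1 => by clear ha hc; omega)
        (fun e1 e2 => by clear ha hb; omega)

set_option maxHeartbeats 4000000 in
lemma code1 {t i a b c : ℕ} (ht : 4 ≤ t) (hi : i < 4*t+1) 
    (ha : a = min (aU t i) (bU t i))
    (hb : b = min (bU t (dd i (2*t-5))) (bV t (dd i (2*t-5))))
    (hc : c = min (bU t (dd i (2*t-4))) (bV t (dd i (2*t-4)))) : Code1 t i a b c := by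
  rcases Nat.mod_two_eq_zero_or_one i with hm | hm
  on_goal 1 =>
    refine
      chain (x := i) 0 (fun h => ?_) fun h =>
      chain (x := i) (2*t-6) (fun h => ?_) fun h =>
      chain (x := i) (2*t-4) (fun h => ?_) fun h =>
      chain (x := i) (2*t-2) (fun h => ?_) fun h =>
      chain (x := i) (2*t) (fun h => ?_) fun h =>
      chain (x := i) (4*t-6) (fun h => ?_) fun h =>
      chain (x := i) (4*t-4) (fun h => ?_) fun h =>
      chain (x := i) (4*t-2) (fun h => ?_) fun h =>
      .inl ?_
  on_goal 10 =>
    refine .inr <| .inr <| .inr <| .inr <| .inr <| .inr <| .inr <| .inr <| .inr <|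
      chain (x := i) 1 (fun h => ?_) fun h =>
      chain (x := i) (2*t-5) (fun h => ?_) fun h =>
      chain (x := i) (2*t-3) (fun h => ?_) fun h =>
      chain (x := i) (2*t-1) (fun h => ?_) fun h =>
      chain (x := i) (4*t-5) (fun h => ?_) fun h =>
      chain (x := i) (4*t-3) (fun h => ?_) fun h =>
      ?_
  all_goals
    first | rw [dd_le (i := i) (by clear ha hb hc; omega)] at hb | rw [dd_ge (i := i) (by clear ha hb hc; omega)] at hb | rw [dd] at hb
    first | rw [dd_le (i := i) (by clear ha hb hc; omega)] at hc | rw [dd_ge (i := i) (by clear ha hb hc; omega)] at hc | rw [dd] at hc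
    first | rw [aU_lo (by clear ha hb hc; omega)] at ha | rw [aU_hi (by clear ha hb hc; omega)] at ha | rw [aU] at ha
    first | rw [bU_lo (by clear ha hb hc; omega)] at ha | rw [bU_hi (by clear ha hb hc; omega)] at ha | rw [bU] at ha
    first | rw [bU_lo (by clear ha hb hc; omega)] at hb | rw [bU_hi (by clear ha hb hc; omega)] at hb | rw [bU] at hb
    first | rw [bV1 (by clear ha hb hc; omega)] at hb | rw [bV2 (by clear ha hb hc; omega)] at hb | rw [bV3 (by clear ha hb hc; omega)] at hb | rw [bV4 (by clear ha hb hc; omega)] at hb | rw [bV] at hb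
    first | rw [bU_lo (by clear ha hb hc; omega)] at hc | rw [bU_hi (by clear ha hb hc; omega)] at hc | rw [bU] at hc
    first | rw [bV1 (by clear ha hb hc; omega)] at hc | rw [bV2 (by clear ha hb hc; omega)] at hc | rw [bV3 (by clear ha hb hc; omega)] at hc | rw [bV4 (by clear ha hb hc; omega)] at hc | rw [bV] at hc
    first
    | exact QA.mk (by clear ha hb hc; omega) (by clear ha hb hc; omega)
        (by clear hb hc; omega) (fun e1 => by clear ha hc; omega)
        (fun e1 e2 => by clear ha hb; omega)
    | exact QB.mk (by clear ha hb hc; omega) (by clear ha hb hc; omega)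
        (by clear hb hc; omega) (fun e1 => by clear ha hc; omega)
        (fun e1 e2 => by clear ha hb; omega)

set_option maxHeartbeats 4000000 in
lemma code2 {t i j a b c : ℕ} (ht : 4 ≤ t) (hi : i < 4*t+1) (hj2 : j < 4*t+1) (hj : j = i + 2 ∨ j + (4*t+1) = i + 2)
    (ha : a = min (bU t i) (bU t j))
    (hb : b = min (bV t (dd i (2*t-5))) (bV t (dd j (2*t-5))))
    (hc : c = min (bV t (dd i (2*t-4))) (bV t (dd j (2*t-4)))) : Code2 t i a b c := by
  rcases Nat.mod_two_eq_zero_or_one i with hm | hm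
  on_goal 1 =>
    refine
      chain (x := i) (2*t-8) (fun h => ?_) fun h =>
      chain (x := i) (2*t-6) (fun h => ?_) fun h =>
      chain (x := i) (2*t-4) (fun h => ?_) fun h =>
      chain (x := i) (2*t-2) (fun h => ?_) fun h =>
      chain (x := i) (4*t-8) (fun h => ?_) fun h =>
      chain (x := i) (4*t-6) (fun h => ?_) fun h =>
      chain (x := i) (4*t-4) (fun h => ?_) fun h =>
      chain (x := i) (4*t-2) (fun h => ?_) fun h =>
      .inl ?_
  on_goal 10 =>
    refine .inr <| .inr <| .inr <| .inr <| .inr <| .inr <| .inr <| .inr <| .inr <|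
      chain (x := i) (2*t-7) (fun h => ?_) fun h =>
      chain (x := i) (2*t-5) (fun h => ?_) fun h =>
      chain (x := i) (2*t-3) (fun h => ?_) fun h =>
      chain (x := i) (2*t-1) (fun h => ?_) fun h =>
      chain (x := i) (4*t-7) (fun h => ?_) fun h =>
      chain (x := i) (4*t-5) (fun h => ?_) fun h =>
      chain (x := i) (4*t-3) (fun h => ?_) fun h =>
      ?_
  all_goals
    first | replace hj : j = i + 2 := by clear ha hb hc; omega | replace hj : j + (4*t+1) = i + 2 := by clear ha hb hc; omega
    first | rw [dd_le (i := i) (by clear ha hb hc; omega)] at hb | rw [dd_ge (i := i) (by clear ha hb hc; omega)] at hb | rw [dd] at hb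
    first | rw [dd_le (i := j) (by clear ha hb hc; omega)] at hb | rw [dd_ge (i := j) (by clear ha hb hc; omega)] at hb | rw [dd] at hb
    first | rw [dd_le (i := i) (by clear ha hb hc; omega)] at hc | rw [dd_ge (i := i) (by clear ha hb hc; omega)] at hc | rw [dd] at hc
    first | rw [dd_le (i := j) (by clear ha hb hc; omega)] at hc | rw [dd_ge (i := j) (by clear ha hb hc; omega)] at hc | rw [dd] at hc
    first | rw [bU_lo (by clear ha hb hc; omega)] at ha | rw [bU_hi (by clear ha hb hc; omega)] at ha | rw [bU] at ha
    first | rw [bU_lo (by clear ha hb hc; omega)] at ha | rw [bU_hi (by clear ha hb hc; omega)] at ha | rw [bU] at ha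
    first | rw [bV1 (by clear ha hb hc; omega)] at hb | rw [bV2 (by clear ha hb hc; omega)] at hb | rw [bV3 (by clear ha hb hc; omega)] at hb | rw [bV4 (by clear ha hb hc; omega)] at hb | rw [bV] at hb
    first | rw [bV1 (by clear ha hb hc; omega)] at hb | rw [bV2 (by clear ha hb hc; omega)] at hb | rw [bV3 (by clear ha hb hc; omega)] at hb | rw [bV4 (by clear ha hb hc; omega)] at hb | rw [bV] at hb
    first | rw [bV1 (by clear ha hb hc; omega)] at hc | rw [bV2 (by clear ha hb hc; omega)] at hc | rw [bV3 (by clear ha hb hc; omega)] at hc | rw [bV4 (by clear ha hb hc; omega)] at hc | rw [bV] at hc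
    first | rw [bV1 (by clear ha hb hc; omega)] at hc | rw [bV2 (by clear ha hb hc; omega)] at hc | rw [bV3 (by clear ha hb hc; omega)] at hc | rw [bV4 (by clear ha hb hc; omega)] at hc | rw [bV] at hc
    first
    | exact QA.mk (by clear ha hb hc; omega) (by clear ha hb hc; omega)
        (by clear hb hc; omega) (fun e1 => by clear ha hc; omega)
        (fun e1 e2 => by clear ha hb; omega)
    | exact QB.mk (by clear ha hb hc; omega) (by clear ha hb hc; omega)
        (by clear hb hc; omega) (fun e1 => by clear ha hc; omega)
        (fun e1 e2 => by clear ha hb; omega)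

set_option maxHeartbeats 4000000 in
lemma uniq00 {t i j a b c : ℕ} (ht : 4 ≤ t) (h : Code0 t i a b c) (h' : Code0 t j a b c) :
    i = j := by
  rcases h with h | h | h | h | h | h | h | h | h | h | h | h | h | h | h | h | h <;> obtain ⟨x1, x2, x3, x4, x5⟩ := h <;>
  rcases h' with h | h | h | h | h | h | h | h | h | h | h | h | h | h | h | h | h <;> obtain ⟨y1, y2, y3, y4, y5⟩ := h <;>
  first
  | exact absurd (add_left_cancel (x4.symm.trans y4)) (by decide)
  | exact absurd (add_left_cancel (x5.symm.trans y5)) (by decide)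
  | omega

set_option maxHeartbeats 4000000 in
lemma uniq01 {t i j a b c : ℕ} (ht : 4 ≤ t) (h : Code0 t i a b c) (h' : Code1 t j a b c) :
    False := by
  rcases h with h | h | h | h | h | h | h | h | h | h | h | h | h | h | h | h | h <;> obtain ⟨x1, x2, x3, x4, x5⟩ := h <;>
  rcases h' with h | h | h | h | h | h | h | h | h | h | h | h | h | h | h | h <;> obtain ⟨y1, y2, y3, y4, y5⟩ := h <;>
  first
  | exact absurd (add_left_cancel (x4.symm.trans y4)) (by decide)
  | exact absurd (add_left_cancel (x5.symm.trans y5)) (by decide)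
  | omega

set_option maxHeartbeats 4000000 in
lemma uniq02 {t i j a b c : ℕ} (ht : 4 ≤ t) (h : Code0 t i a b c) (h' : Code2 t j a b c) :
    False := by
  rcases h with h | h | h | h | h | h | h | h | h | h | h | h | h | h | h | h | h <;> obtain ⟨x1, x2, x3, x4, x5⟩ := h <;>
  rcases h' with h | h | h | h | h | h | h | h | h | h | h | h | h | h | h | h | h <;> obtain ⟨y1, y2, y3, y4, y5⟩ := h <;>
  first
  | exact absurd (add_left_cancel (x4.symm.trans y4)) (by decide)
  | exact absurd (add_left_cancel (x5.symm.trans y5)) (by decide)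
  | omega

set_option maxHeartbeats 4000000 in
lemma uniq11 {t i j a b c : ℕ} (ht : 4 ≤ t) (h : Code1 t i a b c) (h' : Code1 t j a b c) :
    i = j := by
  rcases h with h | h | h | h | h | h | h | h | h | h | h | h | h | h | h | h <;> obtain ⟨x1, x2, x3, x4, x5⟩ := h <;>
  rcases h' with h | h | h | h | h | h | h | h | h | h | h | h | h | h | h | h <;> obtain ⟨y1, y2, y3, y4, y5⟩ := h <;>
  first
  | exact absurd (add_left_cancel (x4.symm.trans y4)) (by decide)
  | exact absurd (add_left_cancel (x5.symm.trans y5)) (by decide)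
  | omega

set_option maxHeartbeats 4000000 in
lemma uniq12 {t i j a b c : ℕ} (ht : 4 ≤ t) (h : Code1 t i a b c) (h' : Code2 t j a b c) :
    False := by
  rcases h with h | h | h | h | h | h | h | h | h | h | h | h | h | h | h | h <;> obtain ⟨x1, x2, x3, x4, x5⟩ := h <;>
  rcases h' with h | h | h | h | h | h | h | h | h | h | h | h | h | h | h | h | h <;> obtain ⟨y1, y2, y3, y4, y5⟩ := h <;>
  first
  | exact absurd (add_left_cancel (x4.symm.trans y4)) (by decide)
  | exact absurd (add_left_cancel (x5.symm.trans y5)) (by decide)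
  | omega

set_option maxHeartbeats 4000000 in
lemma uniq22 {t i j a b c : ℕ} (ht : 4 ≤ t) (h : Code2 t i a b c) (h' : Code2 t j a b c) :
    i = j := by
  rcases h with h | h | h | h | h | h | h | h | h | h | h | h | h | h | h | h | h <;> obtain ⟨x1, x2, x3, x4, x5⟩ := h <;>
  rcases h' with h | h | h | h | h | h | h | h | h | h | h | h | h | h | h | h | h <;> obtain ⟨y1, y2, y3, y4, y5⟩ := h <;>
  first
  | exact absurd (add_left_cancel (x4.symm.trans y4)) (by decide)
  | exact absurd (add_left_cancel (x5.symm.trans y5)) (by decide)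
  | omega


lemma edge_cases {t : ℕ} (ht : 4 ≤ t) (e) (he : e ∈ (GP (4*t+1) 2).edgeSet) :
    (∃ i j : Fin (4*t+1), ((j:ℕ) = i + 1 ∨ (i:ℕ) = 4*t ∧ (j:ℕ) = 0) ∧ e = s(Sum.inl i, Sum.inl j)) ∨
    (∃ i : Fin (4*t+1), e = s(Sum.inl i, Sum.inr i)) ∨
    (∃ i j : Fin (4*t+1), ((j:ℕ) = i + 2 ∨ (j:ℕ) + (4*t+1) = i + 2) ∧ e = s(Sum.inr i, Sum.inr j)) := by
  induction e using Sym2.ind with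
  | _ x y =>
    rw [SimpleGraph.mem_edgeSet] at he
    rcases x with i | i <;> rcases y with j | j
    · left
      rw [gp_adj_uu ht] at he
      rcases he with h | h | h | h
      · exact ⟨i, j, Or.inl h, rfl⟩
      · exact ⟨j, i, Or.inl h, Sym2.eq_swap⟩
      · exact ⟨i, j, Or.inr h, rfl⟩
      · exact ⟨j, i, Or.inr h, Sym2.eq_swap⟩
    · rw [gp_adj_uv] at he
      subst he
      exact Or.inr (Or.inl ⟨i, rfl⟩)
    · rw [gp_adj_vu] at he
      subst he
      exact Or.inr (Or.inl ⟨i, Sym2.eq_swap⟩)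
    · right; right
      rw [gp_adj_vv ht] at he
      rcases he with h | h | h | h
      · exact ⟨i, j, Or.inl h, rfl⟩
      · exact ⟨j, i, Or.inl h, Sym2.eq_swap⟩
      · exact ⟨i, j, Or.inr h.symm, rfl⟩
      · exact ⟨j, i, Or.inr h.symm, Sym2.eq_swap⟩

lemma edge_code {t : ℕ} (ht : 4 ≤ t) (h0 : 0 < 4*t+1) (h1 : 2*t-5 < 4*t+1) (h2 : 2*t-4 < 4*t+1)
    (e) (he : e ∈ (GP (4*t+1) 2).edgeSet) {a b c : ℕ}
    (ha : a = edgeDist (GP (4*t+1) 2) (Sum.inl ⟨0, h0⟩) e)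
    (hb : b = edgeDist (GP (4*t+1) 2) (Sum.inr ⟨2*t-5, h1⟩) e)
    (hc : c = edgeDist (GP (4*t+1) 2) (Sum.inr ⟨2*t-4, h2⟩) e) :
    (∃ i j : Fin (4*t+1), ((j:ℕ) = i + 1 ∨ (i:ℕ) = 4*t ∧ (j:ℕ) = 0) ∧ e = s(Sum.inl i, Sum.inl j) ∧
      Code0 t i a b c) ∨
    (∃ i : Fin (4*t+1), e = s(Sum.inl i, Sum.inr i) ∧ Code1 t i a b c) ∨
    (∃ i j : Fin (4*t+1), ((j:ℕ) = i + 2 ∨ (j:ℕ) + (4*t+1) = i + 2) ∧ e = s(Sum.inr i, Sum.inr j) ∧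
      Code2 t i a b c) := by
  rcases edge_cases ht e he with ⟨i, j, hij, rfl⟩ | ⟨i, rfl⟩ | ⟨i, j, hij, rfl⟩
  all_goals
    simp only [edgeDist, Sym2.lift_mk, dist_u0 ht, dist_v ht, Sum.elim_inl, Sum.elim_inr] at ha hb hc
  · exact Or.inl ⟨i, j, hij, rfl, code0 ht i.2 j.2 hij ha hb hc⟩
  · exact Or.inr (Or.inl ⟨i, rfl, code1 ht i.2 ha hb hc⟩)
  · exact Or.inr (Or.inr ⟨i, j, hij, rfl, code2 ht i.2 j.2 hij ha hb hc⟩)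

lemma is_gen {t : ℕ} (ht : 4 ≤ t) (h0 : 0 < 4*t+1) (h1 : 2*t-5 < 4*t+1) (h2 : 2*t-4 < 4*t+1) :
    IsEdgeGenerator (GP (4 * t + 1) 2)
      {Sum.inl ⟨0, h0⟩, Sum.inr ⟨2 * t - 5, h1⟩, Sum.inr ⟨2 * t - 4, h2⟩} := by
  intro e he f hf h
  have ea := h (Sum.inl ⟨0, h0⟩) (by simp)
  have eb := h (Sum.inr ⟨2*t-5, h1⟩) (by simp)
  have ec := h (Sum.inr ⟨2*t-4, h2⟩) (by simp)
  rcases edge_code ht h0 h1 h2 e he rfl rfl rfl with ⟨i, j, hij, hE, k⟩ | ⟨i, hE, k⟩ | ⟨i, j, hij, hE, k⟩ <;>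
  rcases edge_code ht h0 h1 h2 f hf ea eb ec with
    ⟨i', j', hij', hF, k'⟩ | ⟨i', hF, k'⟩ | ⟨i', j', hij', hF, k'⟩
  · have hi := uniq00 ht k k'
    have hj : (j:ℕ) = j' := by omega
    rw [hE, hF, Fin.ext hi, Fin.ext hj]
  · exact (uniq01 ht k k').elim
  · exact (uniq02 ht k k').elim
  · exact (uniq01 ht k' k).elim
  · rw [hE, hF, Fin.ext (uniq11 ht k k')]
  · exact (uniq12 ht k k').elim
  · exact (uniq02 ht k' k).elim
  · exact (uniq12 ht k' k).elim
  · have hi := uniq22 ht k k'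
    have hj : (j:ℕ) = j' := by omega
    rw [hE, hF, Fin.ext hi, Fin.ext hj]

/-- For `n = 4t+1`, `t ≥ 4`, `{u₀, v_{2t-5}, v_{2t-4}}` is an edge metric
generator of `GP(n,2)`, hence `β_E(GP(4t+1,2)) = 3`. -/
theorem stmt12 (t : ℕ) (ht : 4 ≤ t) :
    IsEdgeGenerator (GP (4 * t + 1) 2)
      {Sum.inl ⟨0, by omega⟩, Sum.inr ⟨2 * t - 5, by omega⟩, Sum.inr ⟨2 * t - 4, by omega⟩} ∧
    edgeMetricDim (GP (4 * t + 1) 2) = 3 := by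
  refine ⟨is_gen ht _ _ _, ?_⟩
  have : Nonempty (Fin (4*t+1) ⊕ Fin (4*t+1)) := ⟨Sum.inl ⟨0, by omega⟩⟩
  apply le_antisymm
  · apply Nat.sInf_le
    refine ⟨{Sum.inl ⟨0, by omega⟩, Sum.inr ⟨2 * t - 5, by omega⟩, Sum.inr ⟨2 * t - 4, by omega⟩},
      Set.toFinite _, ?_, is_gen ht _ _ _⟩
    rw [Set.ncard_eq_three]
    refine ⟨_, _, _, ?_, ?_, ?_, rfl⟩
    · simp
    · simp
    · simp only [ne_eq, Sum.inr.injEq, Fin.mk.injEq]; omega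
  · apply le_csInf
    · exact ⟨_, _, Set.toFinite _, rfl, is_gen ht (by omega) (by omega) (by omega)⟩
    · rintro m ⟨S, hf, rfl, hS⟩
      exact lower _ (gp_three ht) S hf hS
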